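/- For every λ ∈ 𝔻, n ≥ 1, and for σ_{n,λ} the one-point set {λ} with multiplicity n, the interpolation constant satisfies c(σ_{n,λ}, H², H^∞) ≥ (1/(4√2))·√(n/(1-|λ|)). -/

import Mathlib

open Complex Metric

noncomputable def blaschke14 (l z : ℂ) : ℂ := (l - z) / (1 - (starRingEnd ℂ) l * z)

/-- The interpolation constant `c(σ_{n,λ}, H², H^∞)`, where `σ_{n,λ}` is the
one-point set `{λ}` with multiplicity `n`: the sup over the unit ball of `H²`
of the least sup-norm of a bounded holomorphic interpolant `g` with
`g - f ∈ b_λ^n Hol(𝔻)`. -/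
noncomputable def cH2_14 (n : ℕ) (l : ℂ) : ℝ :=
  sSup {t : ℝ | ∃ f : ℂ → ℂ, DifferentiableOn ℂ f (ball (0:ℂ) 1) ∧
    (∀ ρ : ℝ, 0 ≤ ρ → ρ < 1 →
      (1 / (2 * Real.pi)) *
          ∫ θ in (0:ℝ)..(2 * Real.pi),
            ‖f ((ρ : ℂ) * Complex.exp (θ * Complex.I))‖ ^ 2 ≤ 1) ∧
    t = sInf {C : ℝ | 0 ≤ C ∧ ∃ g u : ℂ → ℂ,
      DifferentiableOn ℂ g (ball (0:ℂ) 1) ∧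
      (∀ z ∈ ball (0:ℂ) 1, ‖g z‖ ≤ C) ∧
      DifferentiableOn ℂ u (ball (0:ℂ) 1) ∧
      ∀ z ∈ ball (0:ℂ) 1, g z - f z = (blaschke14 l z) ^ n * u z}}


lemma h14_dcc {g : ℂ → ℂ} (hg : DifferentiableOn ℂ g (ball (0:ℂ) 1)) {ρ : ℝ} (h0 : 0 ≤ ρ)
    (h1 : ρ < 1) : DiffContOnCl ℂ g (ball (0:ℂ) |ρ|) := by
  apply DifferentiableOn.diffContOnCl
  apply hg.mono
  rw [abs_of_nonneg h0]
  exact closure_ball_subset_closedBall.trans (closedBall_subset_ball h1)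

lemma h14_sphere {ρ : ℝ} (h0 : 0 ≤ ρ) {z : ℂ} (hz : z ∈ sphere (0:ℂ) |ρ|) :
    ‖z‖ = ρ ∧ z * (starRingEnd ℂ) z = (ρ:ℂ)^2 := by
  have : ‖z‖ = ρ := by simpa [abs_of_nonneg h0] using hz
  refine ⟨this, ?_⟩
  rw [Complex.mul_conj, Complex.normSq_eq_norm_sq, this]; push_cast; rfl

lemma h14_cint {E : Type*} [NormedAddCommGroup E] {f : ℂ → E} (hf : ContinuousOn f (ball (0:ℂ) 1)) {ρ : ℝ} (h0 : 0 ≤ ρ)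
    (h1 : ρ < 1) : CircleIntegrable f 0 ρ := by
  apply ContinuousOn.circleIntegrable h0
  apply hf.mono
  intro z hz
  simp at hz ⊢
  linarith

/-- reproducing property -/
lemma h14_repr {g : ℂ → ℂ} (hg : DifferentiableOn ℂ g (ball (0:ℂ) 1)) {ρ : ℝ} (h0 : 0 ≤ ρ)
    (h1 : ρ < 1) {l : ℂ} (hl : ‖l‖ < 1) :
    Real.circleAverage (fun z => g z * (starRingEnd ℂ) (1 / (1 - (starRingEnd ℂ) l * z))) 0 ρ
      = g (l * (ρ:ℂ)^2) := by
  rcases h0.eq_or_lt with rfl | hρ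
  · simp
  have hw : l * (ρ:ℂ)^2 ∈ ball (0:ℂ) |ρ| := by
    simp [abs_of_nonneg h0]
    nlinarith [norm_nonneg l]
  rw [← (h14_dcc hg h0 h1).circleAverage_smul_div hw]
  apply Real.circleAverage_congr_sphere
  intro z hz
  obtain ⟨hz1, hz2⟩ := h14_sphere h0 hz
  have hz0 : z ≠ 0 := by
    rintro rfl; simp at hz1; linarith
  have e : z - l * (ρ:ℂ)^2 = z * (1 - l * (starRingEnd ℂ) z) := by
    rw [← hz2]; ring
  simp only [map_div₀, map_one, map_sub, map_mul, Complex.conj_conj, sub_zero, smul_eq_mul, e]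
  rw [div_mul_eq_div_div, div_self hz0, mul_comm]

lemma h14_mv {g : ℂ → ℂ} (hg : DifferentiableOn ℂ g (ball (0:ℂ) 1)) {ρ : ℝ} (h0 : 0 ≤ ρ)
    (h1 : ρ < 1) : Real.circleAverage g 0 ρ = g 0 := by
  exact (h14_dcc hg h0 h1).circleAverage

lemma h14_van {g : ℂ → ℂ} (hg : DifferentiableOn ℂ g (ball (0:ℂ) 1)) {ρ : ℝ} (h0 : 0 ≤ ρ)
    (h1 : ρ < 1) {m k : ℕ} (hkm : k < m) :
    Real.circleAverage (fun z => z ^ m * g z * (starRingEnd ℂ) z ^ k) 0 ρ = 0 := by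
  have h : Set.EqOn (fun z => z ^ m * g z * (starRingEnd ℂ) z ^ k)
      (fun z => ((ρ:ℂ)^2)^k * (z ^ (m-k) * g z)) (sphere 0 |ρ|) := by
    intro z hz
    obtain ⟨hz1, hz2⟩ := h14_sphere h0 hz
    obtain ⟨d, rfl⟩ := Nat.exists_eq_add_of_lt hkm
    simp only [show k + d + 1 - k = d + 1 by omega]
    rw [← hz2]; ring
  rw [Real.circleAverage_congr_sphere h, h14_mv _ h0 h1]
  · have : m - k ≠ 0 := by omega
    simp [this]
  · fun_prop

lemma h14_conj (g : ℂ → ℂ) (hg : Continuous g) {ρ : ℝ} (h0 : 0 ≤ ρ) (h1 : ρ < 1) :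
    Real.circleAverage (fun z => (starRingEnd ℂ) (g z)) 0 ρ
      = (starRingEnd ℂ) (Real.circleAverage g 0 ρ) := 
  (Complex.conjCLE : ℂ →L[ℝ] ℂ).circleAverage_comp_comm (h14_cint hg.continuousOn h0 h1)

lemma h14_re (g : ℂ → ℂ) (hg : ContinuousOn g (ball 0 1)) {ρ : ℝ} (h0 : 0 ≤ ρ) (h1 : ρ < 1) :
    Real.circleAverage (fun z => (g z).re) 0 ρ
      = (Real.circleAverage g 0 ρ).re := 
  Complex.reCLM.circleAverage_comp_comm (h14_cint hg h0 h1)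

lemma h14_mom {ρ : ℝ} (h0 : 0 ≤ ρ) (h1 : ρ < 1) (a b : ℕ) :
    Real.circleAverage (fun z => z ^ a * (starRingEnd ℂ) z ^ b) 0 ρ
      = if a = b then (ρ:ℂ)^(2*b) else 0 := by
  rcases lt_trichotomy a b with h | rfl | h
  · have := h14_van (g := fun _ => 1) (by fun_prop) h0 h1 h
    have h2 := h14_conj (fun z => z ^ b * 1 * (starRingEnd ℂ) z ^ a) (by fun_prop) h0 h1
    rw [this] at h2
    simp only [h.ne, if_false]
    rw [map_zero] at h2
    rw [← h2]
    congr 1; ext z; simp; ring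
  · simp only [if_true]
    apply Real.circleAverage_const_on_circle
    intro z hz
    rw [← mul_pow, (h14_sphere h0 hz).2, pow_mul]
  · have := h14_van (g := fun _ => 1) (by fun_prop) h0 h1 h
    simpa [h.ne'] using this

lemma h14_norm {g : ℂ → ℂ} {h : ℂ → ℝ} (hh : ContinuousOn h (ball 0 1)) {ρ : ℝ} (h0 : 0 ≤ ρ) (h1 : ρ < 1)
    (H : ∀ z ∈ ball (0:ℂ) 1, ‖g z‖ ≤ h z) :
    ‖Real.circleAverage g 0 ρ‖ ≤ Real.circleAverage h 0 ρ := by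
  unfold Real.circleAverage
  rw [norm_smul, Real.norm_of_nonneg (by positivity), smul_eq_mul]
  gcongr
  apply intervalIntegral.norm_integral_le_of_norm_le (by positivity)
  · refine Filter.Eventually.of_forall fun t _ => H _ ?_
    simp [abs_of_nonneg h0, h1]
  · exact h14_cint hh h0 h1

lemma h14_P2 {ρ : ℝ} (h0 : 0 ≤ ρ) (h1 : ρ < 1) (n : ℕ) :
    Real.circleAverage (fun v => ‖∑ k ∈ Finset.range n, v ^ k‖ ^ 2) 0 ρ ≤ n := by
  have e : (fun v : ℂ => ‖∑ k ∈ Finset.range n, v ^ k‖ ^ 2) = fun v : ℂ =>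
      (∑ i ∈ Finset.range n, ∑ k ∈ Finset.range n, v ^ i * (starRingEnd ℂ) v ^ k).re := by
    ext v
    rw [← Finset.sum_mul_sum]
    have : ∑ k ∈ Finset.range n, (starRingEnd ℂ) v ^ k = (starRingEnd ℂ) (∑ k ∈ Finset.range n, v ^ k) := by
      simp
    rw [this, Complex.mul_conj, Complex.normSq_eq_norm_sq, ofReal_re]
  rw [e, h14_re _ (by fun_prop) h0 h1, Real.circleAverage_fun_sum]
  · have : ∀ i ∈ Finset.range n, Real.circleAverage (fun v => ∑ k ∈ Finset.range n, v ^ i * (starRingEnd ℂ) v ^ k) 0 ρ = (ρ:ℂ)^(2*i) := by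
      intro i hi
      rw [Real.circleAverage_fun_sum]
      · simp only [h14_mom h0 h1]
        rw [Finset.sum_ite_eq, if_pos hi]
      · intro k _; exact h14_cint (by fun_prop) h0 h1
    rw [Finset.sum_congr rfl this, Complex.re_sum]
    calc _ ≤ ∑ i ∈ Finset.range n, (1:ℝ) := by
          apply Finset.sum_le_sum; intro i _
          rw [← Complex.ofReal_pow, ofReal_re]
          exact pow_le_one₀ h0 h1.le
      _ = n := by simp
  · intro k _; exact h14_cint (by fun_prop) h0 h1

lemma h14_trip {ρ : ℝ} (h0 : 0 ≤ ρ) (h1 : ρ < 1) (n d : ℕ) :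
    Real.circleAverage (fun v => ∑ i ∈ Finset.range n, ∑ j ∈ Finset.range n, ∑ k ∈ Finset.range n,
      v ^ (i + j + d) * (starRingEnd ℂ) v ^ k) 0 ρ = ((∑ i ∈ Finset.range n, ∑ j ∈ Finset.range n,
        if i + j + d < n then ρ ^ (2 * (i+j+d)) else 0 : ℝ) : ℂ) := by
  rw [Real.circleAverage_fun_sum (fun _ _ => h14_cint (by fun_prop) h0 h1)]
  push_cast
  refine Finset.sum_congr rfl fun i _ => ?_
  rw [Real.circleAverage_fun_sum (fun _ _ => h14_cint (by fun_prop) h0 h1)]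
  refine Finset.sum_congr rfl fun j _ => ?_
  rw [Real.circleAverage_fun_sum (fun _ _ => h14_cint (by fun_prop) h0 h1)]
  simp only [h14_mom h0 h1]
  rw [Finset.sum_ite_eq]
  simp only [Finset.mem_range]
  split_ifs <;> simp

lemma h14_count {ρ : ℝ} (h0 : 0 ≤ ρ) (h1 : ρ < 1) (n : ℕ) :
    ρ ^ (2 * n) * (n * (n+1) / 2) ≤ ∑ i ∈ Finset.range n, ∑ j ∈ Finset.range n,
        if i + j + 0 < n then ρ ^ (2 * (i+j+0)) else 0 := by
  have hc : ∀ i ∈ Finset.range n, ∑ j ∈ Finset.range n, (if i + j + 0 < n then (1:ℝ) else 0) = (n:ℝ) - i := by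
    intro i hi
    rw [Finset.sum_boole]
    have hi' := Finset.mem_range.1 hi
    have : Finset.filter (fun j => i + j + 0 < n) (Finset.range n) = Finset.range (n - i) := by
      ext j; simp; omega
    rw [this, Finset.card_range, Nat.cast_sub hi'.le]
  have hs : ∑ i ∈ Finset.range n, ((n:ℝ) - i) = n * (n+1) / 2 := by
    rw [Finset.sum_sub_distrib]
    have : ∀ m : ℕ, ∑ i ∈ Finset.range m, (i:ℝ) = m * (m-1)/2 := by
      intro m; induction m with
      | zero => simp
      | succ m ih => rw [Finset.sum_range_succ, ih]; push_cast; ring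
    rw [this]; simp; ring
  rw [← hs, ← Finset.sum_congr rfl hc, Finset.mul_sum]
  refine Finset.sum_le_sum fun i _ => ?_
  rw [Finset.mul_sum]
  refine Finset.sum_le_sum fun j _ => ?_
  split_ifs with h
  · rw [mul_one]; exact pow_le_pow_of_le_one h0 h1.le (by omega)
  · simp

set_option maxHeartbeats 1600000 in
lemma h14_lower {n : ℕ} {C c r ρ : ℝ} (h0 : 0 ≤ ρ) (h1 : ρ < 1) (hc : 0 ≤ c) (hr : 0 ≤ r) (hC : 0 ≤ C)
    {G U : ℂ → ℂ} (hG : DifferentiableOn ℂ G (ball (0:ℂ) 1)) (hU : DifferentiableOn ℂ U (ball (0:ℂ) 1))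
    (hGC : ∀ z ∈ ball (0:ℂ) 1, ‖G z‖ ≤ C)
    (hGU : ∀ z ∈ ball (0:ℂ) 1, G z = c * (1 + r * z) * (∑ k ∈ Finset.range n, z ^ k) + z ^ n * U z) :
    c * (ρ ^ (2 * n) * (n * (n+1) / 2)) ≤ C * n := by
  set P : ℂ → ℂ := fun v => ∑ k ∈ Finset.range n, v ^ k with hP
  have hPc : Continuous P := by fun_prop
  have hPd : Differentiable ℂ P := by fun_prop
  have key1 : ‖Real.circleAverage (fun v => G v * P v * (starRingEnd ℂ) (P v)) 0 ρ‖ ≤ C * n := by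
    calc _ ≤ Real.circleAverage (fun v => C • ‖P v‖^2) 0 ρ := by
          apply h14_norm (by fun_prop) h0 h1
          intro z hz
          rw [norm_mul, norm_mul, RCLike.norm_conj, mul_assoc, ← sq, smul_eq_mul]
          gcongr; exact hGC z hz
      _ = C * Real.circleAverage (fun v => ‖P v‖^2) 0 ρ := by
          rw [Real.circleAverage_fun_smul, smul_eq_mul]
      _ ≤ _ := by gcongr; exact h14_P2 h0 h1 n
  have hPconj : ∀ v, (starRingEnd ℂ) (P v) = ∑ k ∈ Finset.range n, (starRingEnd ℂ) v ^ k := by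
    intro v; simp [P]
  set T : ℕ → ℂ → ℂ := fun d v => ∑ i ∈ Finset.range n, ∑ j ∈ Finset.range n, ∑ k ∈ Finset.range n,
      v ^ (i + j + d) * (starRingEnd ℂ) v ^ k with hT
  have hTP : ∀ d v, T d v = v ^ d * P v * P v * (starRingEnd ℂ) (P v) := by
    intro d v
    rw [hPconj]
    simp only [hT, hP]
    rw [mul_assoc (v^d), Finset.sum_mul_sum, mul_assoc, Finset.sum_mul, Finset.mul_sum]
    refine Finset.sum_congr rfl fun i _ => ?_
    rw [Finset.sum_mul_sum, Finset.mul_sum]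
    refine Finset.sum_congr rfl fun j _ => ?_
    rw [Finset.mul_sum]
    refine Finset.sum_congr rfl fun k _ => ?_
    ring
  have hV : Real.circleAverage (fun v => ∑ k ∈ Finset.range n, v ^ n * (U v * P v) * (starRingEnd ℂ) v ^ k) 0 ρ = 0 := by
    rw [Real.circleAverage_fun_sum]
    · apply Finset.sum_eq_zero
      intro k hk
      exact h14_van (hU.mul hPd.differentiableOn) h0 h1 (Finset.mem_range.1 hk)
    · intro k _
      apply h14_cint _ h0 h1
      have := hU.continuousOn
      fun_prop
  have hTc : ∀ d, Continuous (T d) := by intro d; fun_prop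
  have e : Set.EqOn (fun v => G v * P v * (starRingEnd ℂ) (P v)) (fun v => ((c:ℂ) • T 0 v + ((c * r : ℝ):ℂ) • T 1 v) +
      ∑ k ∈ Finset.range n, v ^ n * (U v * P v) * (starRingEnd ℂ) v ^ k) (sphere 0 |ρ|) := by
    intro v hv
    have hvb : v ∈ ball (0:ℂ) 1 := by
      simpa [(h14_sphere h0 hv).1] using h1
    simp only
    rw [← Finset.mul_sum, ← hPconj, hTP, hTP, hGU v hvb, smul_eq_mul, smul_eq_mul]
    push_cast
    ring
  rw [Real.circleAverage_congr_sphere e, Real.circleAverage_fun_add, hV, add_zero, Real.circleAverage_fun_add,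
    Real.circleAverage_fun_smul, Real.circleAverage_fun_smul, h14_trip h0 h1, h14_trip h0 h1] at key1
  · have hpos : (0:ℝ) ≤ ∑ i ∈ Finset.range n, ∑ j ∈ Finset.range n,
        if i + j + 1 < n then ρ ^ (2 * (i+j+1)) else 0 := by
      refine Finset.sum_nonneg fun i _ => Finset.sum_nonneg fun j _ => ?_
      split_ifs <;> positivity
    rw [smul_eq_mul, smul_eq_mul, ← ofReal_mul, ← ofReal_mul, ← ofReal_add, Complex.norm_real] at key1
    have := (le_abs_self _).trans key1
    have h3 := mul_le_mul_of_nonneg_left (h14_count h0 h1 n) hc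
    have h4 := mul_nonneg (mul_nonneg hc hr) hpos
    linarith
  · exact h14_cint (by have := hTc 0; fun_prop) h0 h1
  · exact h14_cint (by have := hTc 1; fun_prop) h0 h1
  · exact h14_cint (by have := hTc 0; have := hTc 1; fun_prop) h0 h1
  · apply h14_cint _ h0 h1
    have := hU.continuousOn
    fun_prop

lemma h14_ne {l z : ℂ} (hl : ‖l‖ < 1) (hz : ‖z‖ < 1) : 1 - (starRingEnd ℂ) l * z ≠ 0 := by
  intro h
  have h2 : (starRingEnd ℂ) l * z = 1 := (sub_eq_zero.1 h).symm
  have : ‖(starRingEnd ℂ) l * z‖ = 1 := by rw [h2]; simp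
  rw [norm_mul, RCLike.norm_conj] at this
  nlinarith [norm_nonneg l, norm_nonneg z]

lemma h14_blt {l z : ℂ} (hl : ‖l‖ < 1) (hz : ‖z‖ < 1) : ‖blaschke14 l z‖ < 1 := by
  have h := h14_ne hl hz
  unfold blaschke14
  rw [norm_div, div_lt_one (norm_pos_iff.2 h)]
  apply lt_of_pow_lt_pow_left₀ 2 (norm_nonneg _)
  have a1 : ‖l‖^2 < 1 := by nlinarith [norm_nonneg l]
  have a2 : ‖z‖^2 < 1 := by nlinarith [norm_nonneg z]
  simp only [← Complex.normSq_eq_norm_sq, Complex.normSq_apply, sub_re, sub_im, mul_re, mul_im,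
    conj_re, conj_im, one_re, one_im] at a1 a2 ⊢
  nlinarith [mul_pos (sub_pos.2 a1) (sub_pos.2 a2)]

lemma h14_bb1 {l z : ℂ} (hl : ‖l‖ < 1) (hz : ‖z‖ < 1) :
    1 - (starRingEnd ℂ) l * blaschke14 l z = ((1 - ‖l‖^2 : ℝ) : ℂ) / (1 - (starRingEnd ℂ) l * z) := by
  have h := h14_ne hl hz
  have e : ((‖l‖^2 : ℝ):ℂ) = (starRingEnd ℂ) l * l := by
    rw [← Complex.normSq_eq_norm_sq, mul_comm, Complex.mul_conj]
  unfold blaschke14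
  rw [ofReal_sub, e]
  field_simp
  push_cast
  ring

lemma h14_pos {l : ℂ} (hl : ‖l‖ < 1) : 0 < 1 - ‖l‖^2 := by nlinarith [norm_nonneg l]

lemma h14_bb {l z : ℂ} (hl : ‖l‖ < 1) (hz : ‖z‖ < 1) :
    blaschke14 l (blaschke14 l z) = z := by
  have h := h14_ne hl hz
  have hp : ((1 - ‖l‖^2 : ℝ) : ℂ) ≠ 0 := by exact_mod_cast (h14_pos hl).ne'
  have e : ((‖l‖^2 : ℝ):ℂ) = (starRingEnd ℂ) l * l := by
    rw [← Complex.normSq_eq_norm_sq, mul_comm, Complex.mul_conj]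
  rw [blaschke14, h14_bb1 hl hz, div_eq_iff (div_ne_zero hp h)]
  unfold blaschke14
  rw [ofReal_sub, e, mul_div_assoc', eq_div_iff h, sub_mul, div_mul_cancel₀ _ h]
  push_cast
  ring

lemma h14_bd {l : ℂ} (hl : ‖l‖ < 1) : DifferentiableOn ℂ (blaschke14 l) (ball (0:ℂ) 1) := by
  unfold blaschke14
  apply DifferentiableOn.div (by fun_prop) (by fun_prop)
  intro z hz
  exact h14_ne hl (by simpa using hz)

lemma h14_eps (l : ℂ) : ∃ ε : ℂ, ‖ε‖ = 1 ∧ ε * l = -(‖l‖:ℂ) := by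
  by_cases h : l = 0
  · exact ⟨1, by simp [h]⟩
  · refine ⟨-(‖l‖:ℂ)/l, ?_, by field_simp⟩
    have : ‖l‖ ≠ 0 := by simpa using h
    simp [this]

lemma h14_maj (β : ℂ) (hβ : ‖β‖ ≤ 1) (n : ℕ) : ‖∑ k ∈ Finset.range n, β ^ k‖ ^ 2 ≤
    (∑ j ∈ Finset.range n, (1 + 2 * ∑ i ∈ Finset.range j, β ^ (i+1))).re := by
  induction n with
  | zero => simp
  | succ n ih =>
    rw [Finset.sum_range_succ (fun j => (1 + 2 * ∑ i ∈ Finset.range j, β ^ (i+1))) n, Complex.add_re]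
    have e : ∑ k ∈ Finset.range (n+1), β ^ k = 1 + β * ∑ k ∈ Finset.range n, β ^ k := by
      rw [Finset.sum_range_succ', Finset.mul_sum]
      simp only [pow_succ', pow_zero]; ring
    have e2 : ∑ i ∈ Finset.range n, β ^ (i+1) = β * ∑ k ∈ Finset.range n, β ^ k := by
      rw [Finset.mul_sum]; simp only [pow_succ']
    rw [e, e2]
    set Q := ∑ k ∈ Finset.range n, β ^ k
    have h1 : ‖1 + β * Q‖^2 = 1 + 2 * (β * Q).re + ‖β * Q‖^2 := by
      rw [← Complex.normSq_eq_norm_sq, ← Complex.normSq_eq_norm_sq, Complex.normSq_add]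
      simp; ring
    have h2 : ‖β * Q‖^2 ≤ ‖Q‖^2 := by
      rw [norm_mul]
      gcongr
      exact mul_le_of_le_one_left (norm_nonneg _) hβ
    have h3 : (1 + 2 * (β * Q)).re = 1 + 2 * (β*Q).re := by simp
    linarith

lemma h14_alt (x : ℝ) (h0 : 0 ≤ x) (h1 : x ≤ 1) (n : ℕ) : 
    (∑ j ∈ Finset.range n, (1 + 2 * ∑ i ∈ Finset.range j, (-x) ^ (i+1))) ≤ n := by
  calc _ ≤ ∑ j ∈ Finset.range n, (1:ℝ) := by
        refine Finset.sum_le_sum fun j _ => ?_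
        have e2 : ∑ i ∈ Finset.range j, (-x) ^ (i+1) = (-x) * ∑ k ∈ Finset.range j, (-x) ^ k := by
          rw [Finset.mul_sum]; simp only [pow_succ']
        have e3 := geom_sum_mul_neg (-x) j
        have e4 : (-x)^j ≤ 1 := by
          calc (-x)^j ≤ |(-x)^j| := le_abs_self _
            _ = x ^ j := by rw [abs_pow, abs_neg, abs_of_nonneg h0]
            _ ≤ 1 := pow_le_one₀ h0 h1
        have e5 : 0 ≤ ∑ k ∈ Finset.range j, (-x) ^ k := by
          by_contra hh
          push Not at hh
          nlinarith
        rw [e2]; nlinarith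
    _ = n := by simp

noncomputable def h14f (n : ℕ) (l ε z : ℂ) : ℂ :=
  ((Real.sqrt (1 - ‖l‖^2) / Real.sqrt n : ℝ) : ℂ) * (1 / (1 - (starRingEnd ℂ) l * z)) *
    ∑ k ∈ Finset.range n, (ε * blaschke14 l z) ^ k

lemma h14_kd {l : ℂ} (hl : ‖l‖ < 1) : DifferentiableOn ℂ (fun z => 1 / (1 - (starRingEnd ℂ) l * z)) (ball (0:ℂ) 1) := by
  apply DifferentiableOn.div (by fun_prop) (by fun_prop)
  intro z hz
  exact h14_ne hl (by simpa using hz)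

lemma h14_fd {n : ℕ} {l ε : ℂ} (hl : ‖l‖ < 1) :
    DifferentiableOn ℂ (h14f n l ε) (ball (0:ℂ) 1) := by
  unfold h14f
  have h1 := h14_bd hl
  have h2 := h14_kd hl
  fun_prop

lemma h14_H2 {n : ℕ} (hn : 1 ≤ n) {l ε : ℂ} (hl : ‖l‖ < 1) (hε : ‖ε‖ = 1) (hεl : ε * l = -(‖l‖:ℂ))
    {ρ : ℝ} (h0 : 0 ≤ ρ) (h1 : ρ < 1) :
    Real.circleAverage (fun z => ‖h14f n l ε z‖^2) 0 ρ ≤ 1 := by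
  have hs := h14_pos hl
  have hn' : (0:ℝ) < n := by exact_mod_cast hn
  have hb := h14_bd hl
  have hk := h14_kd hl
  set K : ℂ → ℂ := fun z => ∑ j ∈ Finset.range n, (1 + 2 * ∑ i ∈ Finset.range j, (ε * blaschke14 l z) ^ (i+1)) with hK
  have hKd : DifferentiableOn ℂ K (ball 0 1) := by fun_prop
  set k : ℂ → ℂ := fun z => 1 / (1 - (starRingEnd ℂ) l * z) with hkdef
  have hkK : DifferentiableOn ℂ (fun z => k z * K z) (ball 0 1) := by fun_prop
  have hfc : ContinuousOn (fun z => ‖h14f n l ε z‖^2) (ball 0 1) := by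
    have := (h14_fd (n := n) (ε := ε) hl).continuousOn
    fun_prop
  have hcont : ContinuousOn (fun z => k z * K z * (starRingEnd ℂ) (k z)) (ball 0 1) := by
    have a1 := hkK.continuousOn
    have a2 : ContinuousOn (fun z => (starRingEnd ℂ) (k z)) (ball 0 1) :=
      Complex.continuous_conj.comp_continuousOn hk.continuousOn
    exact a1.mul a2
  have hrc : ContinuousOn (fun z => (k z * K z * (starRingEnd ℂ) (k z)).re) (ball 0 1) :=
    Complex.continuous_re.comp_continuousOn hcont
  have step : Real.circleAverage (fun z => ‖h14f n l ε z‖^2) 0 ρ ≤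
      Real.circleAverage (fun z => ((1 - ‖l‖^2)/n) • (k z * K z * (starRingEnd ℂ) (k z)).re) 0 ρ := by
    apply Real.circleAverage_mono (h14_cint hfc h0 h1) (h14_cint (by fun_prop) h0 h1)
    intro z hz
    have hz1 : ‖z‖ < 1 := by rw [(h14_sphere h0 hz).1]; exact h1
    have hm := h14_maj (ε * blaschke14 l z) (by rw [norm_mul, hε, one_mul]; exact (h14_blt hl hz1).le) n
    have e1 : (k z * K z * (starRingEnd ℂ) (k z)).re = ‖k z‖^2 * (K z).re := by
      rw [mul_right_comm, Complex.mul_conj, Complex.normSq_eq_norm_sq, re_ofReal_mul]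
    have e2 : ‖h14f n l ε z‖^2 = ((1 - ‖l‖^2)/n) * (‖k z‖^2 * ‖∑ k ∈ Finset.range n, (ε * blaschke14 l z) ^ k‖^2) := by
      unfold h14f
      rw [norm_mul, norm_mul, Complex.norm_real, Real.norm_of_nonneg (by positivity), mul_pow, mul_pow, div_pow,
        Real.sq_sqrt hs.le, Real.sq_sqrt hn'.le, mul_assoc]
    rw [smul_eq_mul, e1, e2]
    gcongr
  refine step.trans ?_
  rw [Real.circleAverage_fun_smul, h14_re _ hcont h0 h1, h14_repr hkK h0 h1 hl]
  set r := ‖l‖ with hr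
  have hr0 : 0 ≤ r := norm_nonneg l
  have hll : (starRingEnd ℂ) l * l = ((r^2:ℝ):ℂ) := by
    rw [hr, ← Complex.normSq_eq_norm_sq, mul_comm, Complex.mul_conj]
  have hrρ : 0 < 1 - r^2 * ρ^2 := by
    have : r * ρ < 1 := by nlinarith
    nlinarith [mul_nonneg hr0 h0]
  have ek : k (l * (ρ:ℂ)^2) = ((1 / (1 - r^2*ρ^2) : ℝ) : ℂ) := by
    simp only [hkdef]
    rw [← mul_assoc, hll]; push_cast; rfl
  set x := r * (1 - ρ^2) / (1 - r^2*ρ^2) with hx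
  have eb : ε * blaschke14 l (l * (ρ:ℂ)^2) = ((-x : ℝ) : ℂ) := by
    unfold blaschke14
    rw [← mul_assoc _ l, hll, mul_div_assoc', mul_sub, ← mul_assoc, hεl, hx]
    push_cast
    ring
  have eK : K (l * (ρ:ℂ)^2) = ((∑ j ∈ Finset.range n, (1 + 2 * ∑ i ∈ Finset.range j, (-x) ^ (i+1)) : ℝ) : ℂ) := by
    simp only [hK, eb]
    push_cast; rfl
  have hρ2 : ρ^2 < 1 := by nlinarith
  have hx0 : 0 ≤ x := by
    apply div_nonneg (mul_nonneg hr0 (by linarith)) hrρ.le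
  have hx1 : x ≤ 1 := by
    rw [hx, div_le_one hrρ]
    nlinarith [mul_nonneg (sub_nonneg.2 hl.le) (add_nonneg zero_le_one (mul_nonneg hr0 (sq_nonneg ρ)))]
  rw [ek, eK, ← ofReal_mul, ofReal_re, smul_eq_mul]
  have hA := h14_alt x hx0 hx1 n
  calc _ ≤ (1 - r^2)/n * (1 / (1 - r^2*ρ^2) * n) := by gcongr
    _ = (1 - r^2) / (1 - r^2*ρ^2) := by field_simp
    _ ≤ 1 := by
      rw [div_le_one hrρ]
      nlinarith [sq_nonneg r]

lemma h14_low {n : ℕ} (hn : 1 ≤ n) {l ε : ℂ} (hl : ‖l‖ < 1) (hε : ‖ε‖ = 1) (hεl : ε * l = -(‖l‖:ℂ))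
    {C : ℝ} (hC : 0 ≤ C) {g u : ℂ → ℂ} (hg : DifferentiableOn ℂ g (ball (0:ℂ) 1))
    (hgC : ∀ z ∈ ball (0:ℂ) 1, ‖g z‖ ≤ C) (hu : DifferentiableOn ℂ u (ball (0:ℂ) 1))
    (hgu : ∀ z ∈ ball (0:ℂ) 1, g z - h14f n l ε z = (blaschke14 l z) ^ n * u z) :
    (1 / (4 * Real.sqrt 2)) * Real.sqrt (n / (1 - ‖l‖)) ≤ C := by
  have hs := h14_pos hl
  have hn' : (0:ℝ) < n := by exact_mod_cast hn
  have hn1 : (1:ℝ) ≤ n := by exact_mod_cast hn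
  set ε' := (starRingEnd ℂ) ε with hε'
  have hee : ε * ε' = 1 := by
    rw [Complex.mul_conj, Complex.normSq_eq_norm_sq, hε]; simp
  have hεn' : ‖ε'‖ = 1 := by rw [hε', RCLike.norm_conj, hε]
  have hmap0 : ∀ v ∈ ball (0:ℂ) 1, ‖ε' * v‖ < 1 := by
    intro v hv; rw [norm_mul, hεn', one_mul]; simpa using hv
  set φ : ℂ → ℂ := fun v => blaschke14 l (ε' * v) with hφ
  have hφm : Set.MapsTo φ (ball 0 1) (ball 0 1) := by
    intro v hv
    simpa using h14_blt hl (hmap0 v hv)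
  have hφd : DifferentiableOn ℂ φ (ball 0 1) :=
    (h14_bd hl).comp (by fun_prop) (fun v hv => by simpa using hmap0 v hv)
  set c : ℝ := 1 / (Real.sqrt n * Real.sqrt (1 - ‖l‖^2)) with hc
  have hlc : (starRingEnd ℂ) l * ε' = -(‖l‖:ℂ) := by
    rw [hε', ← map_mul, mul_comm, hεl]; simp
  have hsq : Real.sqrt (1 - ‖l‖^2) * Real.sqrt (1 - ‖l‖^2) = 1 - ‖l‖^2 := Real.mul_self_sqrt hs.le
  have hsp : 0 < Real.sqrt (1 - ‖l‖^2) := Real.sqrt_pos.2 hs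
  have hnp : 0 < Real.sqrt n := Real.sqrt_pos.2 hn'
  have hfφ : ∀ v ∈ ball (0:ℂ) 1, h14f n l ε (φ v) = c * (1 + ‖l‖ * v) * (∑ k ∈ Finset.range n, v ^ k) := by
    intro v hv
    simp only [hφ, h14f]
    rw [h14_bb1 hl (hmap0 v hv), h14_bb hl (hmap0 v hv), ← mul_assoc ε, hee, one_mul, ← mul_assoc ((starRingEnd ℂ) l), hlc]
    congr 1
    have e : Real.sqrt (1 - ‖l‖^2) / Real.sqrt n = c * (1 - ‖l‖^2) := by
      rw [hc]; field_simp; nlinarith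
    rw [e]
    have hp : ((1 - ‖l‖^2 : ℝ) : ℂ) ≠ 0 := by exact_mod_cast hs.ne'
    rw [ofReal_mul, one_div_div]
    field_simp
    ring
  set ρ : ℝ := 1 - 1 / (4 * n) with hρ
  have hq : 0 < 1 / (4 * (n:ℝ)) ∧ 1 / (4 * (n:ℝ)) ≤ 1/4 := by
    refine ⟨by positivity, ?_⟩
    apply one_div_le_one_div_of_le <;> linarith
  have main := h14_lower (n := n) (C := C) (c := c) (r := ‖l‖) (ρ := ρ) (G := fun v => g (φ v))
    (U := fun v => ε' ^ n * u (φ v)) (by linarith) (by linarith) (by positivity) (norm_nonneg l) hC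
    (hg.comp hφd hφm) ((hu.comp hφd hφm).const_mul _) (fun v hv => hgC _ (hφm hv)) (by
      intro v hv
      have := hgu _ (hφm hv)
      rw [sub_eq_iff_eq_add', hfφ v hv] at this
      have hbv : blaschke14 l (φ v) = ε' * v := h14_bb hl (hmap0 v hv)
      rw [this, hbv, mul_pow]
      ring)
  have hρn : 1/2 ≤ ρ ^ (2*n) := by
    have := one_add_mul_le_pow (a := -(1/(4*(n:ℝ)))) (by linarith) (2*n)
    have e : 1 + ((2 * n : ℕ):ℝ) * -(1/(4*(n:ℝ))) = 1/2 := by push_cast; field_simp; norm_num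
    rw [e] at this
    rw [hρ, sub_eq_add_neg]; exact this
  have h2 : c * (1/2 * (n * (n+1)/2)) ≤ C * n := by
    refine le_trans ?_ main
    gcongr
  have h3 : c * n / 4 ≤ C := by
    have : c * (n+1) / 4 ≤ C := by
      apply le_of_mul_le_mul_right _ hn'
      calc _ = c * (1/2 * (n * (n+1)/2)) := by ring
        _ ≤ _ := h2
    have hc0 : 0 ≤ c := by positivity
    nlinarith
  refine le_trans ?_ h3
  have hl1 : 0 < 1 - ‖l‖ := by linarith
  have h4 : Real.sqrt (1 - ‖l‖^2) ≤ Real.sqrt 2 * Real.sqrt (1 - ‖l‖) := by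
    rw [← Real.sqrt_mul (by norm_num)]
    apply Real.sqrt_le_sqrt
    nlinarith [norm_nonneg l]
  have h5 : c * n / 4 = Real.sqrt n / (4 * Real.sqrt (1 - ‖l‖^2)) := by
    rw [hc]
    have : Real.sqrt n * Real.sqrt n = n := Real.mul_self_sqrt hn'.le
    field_simp
    nlinarith
  rw [h5, Real.sqrt_div hn'.le]
  have h6 : 0 < Real.sqrt (1 - ‖l‖) := Real.sqrt_pos.2 hl1
  rw [div_mul_div_comm, one_mul]
  apply div_le_div_of_nonneg_left hnp.le (by positivity)
  linarith

lemma h14_sup {f : ℂ → ℂ} (hf : DifferentiableOn ℂ f (ball (0:ℂ) 1)) {ρ r : ℝ} (h1 : ρ < 1)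
    (hr0 : 0 ≤ r) (hr : r < ρ) (hM : Real.circleAverage (fun z => ‖f z‖^2) 0 ρ ≤ 1) {w : ℂ} (hw : ‖w‖ ≤ r) :
    ‖f w‖ ≤ ρ / (ρ - r) := by
  have h0 : 0 ≤ ρ := by linarith
  have hw' : w ∈ ball (0:ℂ) |ρ| := by
    simp [abs_of_nonneg h0]; linarith
  have hd : 0 < ρ - r := by linarith
  rw [← (h14_dcc hf h0 h1).circleAverage_smul_div hw']
  have hc := hf.continuousOn
  have hci : CircleIntegrable (fun z => ‖f z‖^2) 0 ρ := h14_cint (by fun_prop) h0 h1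
  have hc1 : CircleIntegrable (fun _ : ℂ => (1:ℝ)) 0 ρ := h14_cint (by fun_prop) h0 h1
  calc _ ≤ Real.circleAverage (fun z => (ρ / (ρ - r) / 2) • (1 + ‖f z‖^2)) 0 ρ := by
        unfold Real.circleAverage
        rw [norm_smul, Real.norm_of_nonneg (by positivity), smul_eq_mul]
        gcongr
        apply intervalIntegral.norm_integral_le_of_norm_le (by positivity)
        · refine Filter.Eventually.of_forall fun t _ => ?_
          set z := circleMap 0 ρ t with hz
          have hzn : ‖z‖ = ρ := by simp [hz, abs_of_nonneg h0]
          have h3 : ρ - r ≤ ‖z - w‖ := by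
            have := norm_sub_norm_le z w
            linarith
          rw [norm_smul, norm_div, sub_zero, hzn]
          have h4 : ‖f z‖ ≤ (1 + ‖f z‖^2)/2 := by nlinarith [sq_nonneg (‖f z‖ - 1)]
          calc _ ≤ ρ / (ρ - r) * ((1 + ‖f z‖^2)/2) := by gcongr
            _ = _ := by simp only [smul_eq_mul]; ring
        · exact h14_cint (f := fun z => (ρ / (ρ - r) / 2) • (1 + ‖f z‖^2)) (by fun_prop) h0 h1
    _ = (ρ / (ρ - r) / 2) * (1 + Real.circleAverage (fun z => ‖f z‖^2) 0 ρ) := by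
        rw [Real.circleAverage_fun_smul, Real.circleAverage_fun_add hc1 hci, Real.circleAverage_const, smul_eq_mul]
    _ ≤ (ρ / (ρ - r) / 2) * (1 + 1) := by gcongr
    _ = _ := by ring

lemma h14_taylor {l : ℂ} {r : ℝ} (hlr : ‖l‖ < r) (hr : r < 1) (M : ℝ) (n : ℕ) :
    ∃ D N : ℝ, ∀ f : ℂ → ℂ, DifferentiableOn ℂ f (ball (0:ℂ) 1) → (∀ z ∈ closedBall (0:ℂ) r, ‖f z‖ ≤ M) →
      ∃ g h : ℂ → ℂ, DifferentiableOn ℂ g (ball (0:ℂ) 1) ∧ DifferentiableOn ℂ h (ball (0:ℂ) 1) ∧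
        (∀ z ∈ ball (0:ℂ) 1, ‖g z‖ ≤ D) ∧ (∀ z ∈ closedBall (0:ℂ) r, ‖h z‖ ≤ N) ∧
        ∀ z, f z = g z + (z - l) ^ n * h z := by
  have hr0 : 0 < r := lt_of_le_of_lt (norm_nonneg l) hlr
  induction n with
  | zero =>
    refine ⟨0, M, fun f hf hM => ⟨fun _ => 0, f, by fun_prop, hf, by simp, hM, by simp⟩⟩
  | succ n ih =>
    obtain ⟨D, N, H⟩ := ih
    refine ⟨D + 2 ^ n * N, 2 * N / (r - ‖l‖), fun f hf hM => ?_⟩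
    obtain ⟨g, h, hg, hh, hgD, hhN, he⟩ := H f hf hM
    have hl1 : l ∈ ball (0:ℂ) 1 := by simp; linarith
    have hlr' : l ∈ closedBall (0:ℂ) r := by simp; linarith
    have hN : 0 ≤ N := (norm_nonneg _).trans (hhN l hlr')
    have hdd : DifferentiableOn ℂ (dslope h l) (ball 0 1) :=
      (Complex.differentiableOn_dslope (isOpen_ball.mem_nhds hl1)).2 hh
    refine ⟨fun z => g z + (z - l)^n * h l, dslope h l, by fun_prop, hdd, ?_, ?_, ?_⟩
    · intro z hz
      refine (norm_add_le _ _).trans ?_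
      rw [norm_mul, norm_pow]
      have : ‖z - l‖ ≤ 2 := by
        have := norm_sub_le z l
        simp at hz
        linarith
      have h2 := hgD z hz
      have h3 := hhN l hlr'
      gcongr
    · intro z hz
      rw [← closure_ball _ hr0.ne'] at hz
      have hd : DiffContOnCl ℂ (dslope h l) (ball 0 r) := by
        have := h14_dcc hdd hr0.le hr
        rwa [abs_of_pos hr0] at this
      refine Complex.norm_le_of_forall_mem_frontier_norm_le isBounded_ball hd ?_ hz
      intro w hw
      rw [frontier_ball _ hr0.ne'] at hw
      have hwn : ‖w‖ = r := by simpa using hw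
      have hwl : w ≠ l := by rintro rfl; linarith
      rw [dslope_of_ne _ hwl, slope_def_field, norm_div]
      have h3 : r - ‖l‖ ≤ ‖w - l‖ := by
        have := norm_sub_norm_le w l
        linarith
      have h4 : 0 < r - ‖l‖ := by linarith
      have h5 : ‖h w - h l‖ ≤ 2 * N := by
        refine (norm_sub_le _ _).trans ?_
        have a := hhN w (sphere_subset_closedBall hw)
        have b := hhN l hlr'
        linarith
      gcongr
    · intro z
      have := sub_smul_dslope h l z
      rw [smul_eq_mul] at this
      rw [pow_succ, mul_assoc, this, he z]
      ring

/-- `c(σ_{n,λ}, H², H^∞) ≥ (1/(4√2)) √(n/(1-|λ|))`. -/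
theorem stmt_14 (n : ℕ) (hn : 1 ≤ n) (l : ℂ) (hl : ‖l‖ < 1) :
    (1 / (4 * Real.sqrt 2)) * Real.sqrt (n / (1 - ‖l‖)) ≤ cH2_14 n l := by
  set r := (1 + ‖l‖) / 2 with hr
  have hln := norm_nonneg l
  have hlr : ‖l‖ < r := by rw [hr]; linarith
  have hr1 : r < 1 := by rw [hr]; linarith
  set ρ := (1 + r) / 2 with hρ
  have hrρ : r < ρ := by rw [hρ]; linarith
  have hρ1 : ρ < 1 := by rw [hρ]; linarith
  have hconv : ∀ (f : ℂ → ℂ) (ρ : ℝ), (1 / (2 * Real.pi)) *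
          ∫ θ in (0:ℝ)..(2 * Real.pi),
            ‖f ((ρ : ℂ) * Complex.exp (θ * Complex.I))‖ ^ 2
          = Real.circleAverage (fun z => ‖f z‖^2) 0 ρ := by
    intro f ρ
    simp [Real.circleAverage, circleMap]
  obtain ⟨D, N, H⟩ := h14_taylor hlr hr1 (ρ / (ρ - r)) n
  obtain ⟨ε, hε, hεl⟩ := h14_eps l
  have hup : ∀ f : ℂ → ℂ, DifferentiableOn ℂ f (ball (0:ℂ) 1) →
      (∀ ρ : ℝ, 0 ≤ ρ → ρ < 1 → (1 / (2 * Real.pi)) *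
          ∫ θ in (0:ℝ)..(2 * Real.pi),
            ‖f ((ρ : ℂ) * Complex.exp (θ * Complex.I))‖ ^ 2 ≤ 1) →
      D ∈ {C : ℝ | 0 ≤ C ∧ ∃ g u : ℂ → ℂ,
      DifferentiableOn ℂ g (ball (0:ℂ) 1) ∧
      (∀ z ∈ ball (0:ℂ) 1, ‖g z‖ ≤ C) ∧
      DifferentiableOn ℂ u (ball (0:ℂ) 1) ∧
      ∀ z ∈ ball (0:ℂ) 1, g z - f z = (blaschke14 l z) ^ n * u z} := by
    intro f hf hM
    have hM' := hM ρ (by linarith) hρ1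
    rw [hconv] at hM'
    obtain ⟨g, h, hg, hh, hgD, -, he⟩ := H f hf (fun z hz =>
      h14_sup hf hρ1 (by linarith) hrρ hM' (by simpa using hz))
    refine ⟨(norm_nonneg _).trans (hgD 0 (by simp)), g,
      fun z => - (-(1 - (starRingEnd ℂ) l * z)) ^ n * h z, hg, hgD, by fun_prop, ?_⟩
    intro z hz
    have hne := h14_ne hl (show ‖z‖ < 1 by simpa using hz)
    have e : z - l = blaschke14 l z * (-(1 - (starRingEnd ℂ) l * z)) := by
      unfold blaschke14
      rw [mul_neg, div_mul_cancel₀ _ hne]; ring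
    rw [he z, e, mul_pow]
    ring
  unfold cH2_14
  have hfd := h14_fd (n := n) (ε := ε) hl
  have hf2 : ∀ ρ : ℝ, 0 ≤ ρ → ρ < 1 → (1 / (2 * Real.pi)) *
          ∫ θ in (0:ℝ)..(2 * Real.pi),
            ‖h14f n l ε ((ρ : ℂ) * Complex.exp (θ * Complex.I))‖ ^ 2 ≤ 1 := by
    intro ρ h0 h1
    rw [hconv]
    exact h14_H2 hn hl hε hεl h0 h1
  refine le_csSup_of_le ?_ ⟨h14f n l ε, hfd, hf2, rfl⟩ ?_
  · refine ⟨D, ?_⟩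
    rintro t ⟨f, hf, hM, rfl⟩
    exact csInf_le ⟨0, fun _ hC => hC.1⟩ (hup f hf hM)
  · apply le_csInf ⟨D, hup _ hfd hf2⟩
    rintro C ⟨hC, g, u, hg, hgC, hu, hgu⟩
    exact h14_low hn hl hε hεl hC hg hgC hu hgu
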